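/- For every δ > 0, the parameter β′ admits the closed form β′(δ) = ∫₀^δ ϖ_l(z) dz = (∫₀^δ m_l(z) dz)/m(δ) = (2δ⁵/5)/(πδ⁴/2) = 4δ/(5π). -/

import Mathlib

open MeasureTheory Real

/-- Polar integration over a disk of a function that is homogeneous of degree `n` with angular
profile `h`. -/
theorem Complex.setIntegral_closedDisk_of_polar {δ : ℝ} (hδ : 0 ≤ δ) (n : ℕ) (f : ℂ → ℝ) (h : ℝ → ℝ)
    (hf : ∀ r θ : ℝ, 0 < r → f (Complex.polarCoord.symm (r, θ)) = r ^ n * h θ) :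
    ∫ w in {w : ℂ | ‖w‖ ≤ δ}, f w = δ ^ (n + 2) / (n + 2) * ∫ θ in Set.Ioo (-π) π, h θ := by
  have hmeas : MeasurableSet {w : ℂ | ‖w‖ ≤ δ} := measurableSet_le measurable_norm measurable_const
  rw [← integral_indicator hmeas, ← Complex.integral_comp_polarCoord_symm]
  have hcongr : ∀ p ∈ _root_.polarCoord.target,
      p.1 • {w : ℂ | ‖w‖ ≤ δ}.indicator f (Complex.polarCoord.symm p) =
        (Set.Iic δ).indicator (fun r : ℝ => r ^ (n + 1)) p.1 * h p.2 := by
    rintro ⟨r, θ⟩ hp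
    have hr : 0 < r := hp.1
    by_cases hle : r ≤ δ
    · rw [Set.indicator_of_mem (by simpa [abs_of_pos hr] using hle), Set.indicator_of_mem (Set.mem_Iic.2 hle),
        hf r θ hr, smul_eq_mul]
      ring
    · rw [Set.indicator_of_notMem (by simpa [abs_of_pos hr] using hle),
        Set.indicator_of_notMem (Set.notMem_Iic.2 (not_le.1 hle))]
      simp
  rw [setIntegral_congr_fun (by exact _root_.polarCoord.open_target.measurableSet) hcongr,
    polarCoord_target, Measure.volume_eq_prod,
    setIntegral_prod_mul (f := (Set.Iic δ).indicator (fun r : ℝ => r ^ (n + 1))),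
    setIntegral_indicator measurableSet_Iic, Set.Ioi_inter_Iic,
    ← intervalIntegral.integral_of_le hδ, integral_pow]
  congr 1
  push_cast
  ring

/-- Polar integration over a disk in the Euclidean plane. -/
theorem EuclideanSpace.setIntegral_disk_of_polar {δ : ℝ} (hδ : 0 ≤ δ) (n : ℕ)
    (f : EuclideanSpace ℝ (Fin 2) → ℝ) (h : ℝ → ℝ)
    (hf : ∀ r θ : ℝ, 0 < r → f !₂[r * cos θ, r * sin θ] = r ^ n * h θ) :
    ∫ ξ in {ξ : EuclideanSpace ℝ (Fin 2) | ‖ξ‖ ≤ δ}, f ξ =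
      δ ^ (n + 2) / (n + 2) * ∫ θ in Set.Ioo (-π) π, h θ := by
  have he := Complex.orthonormalBasisOneI.measurePreserving_repr
  rw [← he.setIntegral_preimage_emb
    Complex.orthonormalBasisOneI.repr.toHomeomorph.measurableEmbedding]
  have hpre : Complex.orthonormalBasisOneI.repr ⁻¹' {ξ : EuclideanSpace ℝ (Fin 2) | ‖ξ‖ ≤ δ} =
      {w : ℂ | ‖w‖ ≤ δ} := by
    ext w
    simp
  rw [hpre]
  refine Complex.setIntegral_closedDisk_of_polar hδ n _ h fun r θ hr => ?_
  rw [← hf r θ hr]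
  congr 1

theorem integral_max_sin_zero : ∫ θ in Set.Ioo (-π) π, max (sin θ) 0 = 2 := by
  have hc : Continuous fun θ : ℝ => max (sin θ) 0 := by fun_prop
  rw [← integral_Ioc_eq_integral_Ioo, ← intervalIntegral.integral_of_le (by linarith [pi_pos]),
    ← intervalIntegral.integral_add_adjacent_intervals (hc.intervalIntegrable (-π) 0)
      (hc.intervalIntegrable 0 π)]
  have hneg : ∫ θ in (-π)..0, max (sin θ) 0 = ∫ θ in (-π)..0, (0 : ℝ) := by
    refine intervalIntegral.integral_congr fun θ hθ => ?_
    rw [Set.uIcc_of_le (by linarith [pi_pos])] at hθ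
    exact max_eq_right (sin_nonpos_of_nonpos_of_neg_pi_le hθ.2 hθ.1)
  have hpos : ∫ θ in (0 : ℝ)..π, max (sin θ) 0 = ∫ θ in (0 : ℝ)..π, sin θ := by
    refine intervalIntegral.integral_congr fun θ hθ => ?_
    rw [Set.uIcc_of_le pi_pos.le] at hθ
    exact max_eq_left (sin_nonneg_of_mem_Icc hθ)
  rw [hneg, hpos, integral_sin]
  norm_num

/-- Integrating the second moments of the segments `ξ₂ ≥ z` over `z ∈ [0, δ]` gives the moment of
`‖ξ‖² ξ₂⁺` over the disk. -/
theorem integral_segmentMoment {δ : ℝ} (hδ : 0 ≤ δ) :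
    ∫ z in (0 : ℝ)..δ, ∫ ξ in {ξ : EuclideanSpace ℝ (Fin 2) | ‖ξ‖ ≤ δ ∧ z ≤ ξ 1}, ‖ξ‖ ^ 2 =
      ∫ ξ in {ξ : EuclideanSpace ℝ (Fin 2) | ‖ξ‖ ≤ δ}, ‖ξ‖ ^ 2 * max (ξ 1) 0 := by
  set D := {ξ : EuclideanSpace ℝ (Fin 2) | ‖ξ‖ ≤ δ} with hD
  have hDmeas : MeasurableSet D := measurableSet_le measurable_norm measurable_const
  have hDball : D = Metric.closedBall 0 δ := by
    ext ξ
    simp [hD]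
  have : IsFiniteMeasure (volume.restrict D) :=
    isFiniteMeasure_restrict.2 (hDball ▸ measure_closedBall_lt_top.ne)
  have hHmeas (z : ℝ) : MeasurableSet {ξ : EuclideanSpace ℝ (Fin 2) | z ≤ ξ 1} :=
    measurableSet_le measurable_const (by fun_prop)
  have hSmeas : MeasurableSet {p : ℝ × EuclideanSpace ℝ (Fin 2) | p.1 ≤ p.2 1} :=
    measurableSet_le measurable_fst (by fun_prop)
  let F : ℝ → EuclideanSpace ℝ (Fin 2) → ℝ := fun z ξ =>
    {p : ℝ × EuclideanSpace ℝ (Fin 2) | p.1 ≤ p.2 1}.indicator (fun p => ‖p.2‖ ^ 2) (z, ξ)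
  have hFint : Integrable (Function.uncurry F)
      ((volume.restrict (Set.Ioc 0 δ)).prod (volume.restrict D)) := by
    refine Integrable.of_bound (C := δ ^ 2)
      (Measurable.indicator (by fun_prop) hSmeas).aestronglyMeasurable ?_
    rw [Measure.prod_restrict]
    filter_upwards [ae_restrict_mem (measurableSet_Ioc.prod hDmeas)] with p hp
    refine (norm_indicator_le_norm_self (fun p : ℝ × EuclideanSpace ℝ (Fin 2) => ‖p.2‖ ^ 2) p).trans ?_
    have hle : ‖p.2‖ ≤ δ := hp.2
    rw [norm_pow, norm_norm]
    gcongr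
  have hleft (z : ℝ) : ∫ ξ in {ξ : EuclideanSpace ℝ (Fin 2) | ‖ξ‖ ≤ δ ∧ z ≤ ξ 1}, ‖ξ‖ ^ 2 =
      ∫ ξ in D, F z ξ := by
    have hF : F z = {ξ : EuclideanSpace ℝ (Fin 2) | z ≤ ξ 1}.indicator fun ξ => ‖ξ‖ ^ 2 := rfl
    rw [hF, setIntegral_indicator (hHmeas z)]
    rfl
  simp_rw [hleft]
  rw [intervalIntegral.integral_of_le hδ, integral_integral_swap hFint]
  refine setIntegral_congr_fun hDmeas fun ξ hξ => ?_
  have hle : ξ 1 ≤ δ := (le_abs_self _).trans ((PiLp.norm_apply_le ξ 1).trans hξ)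
  have hF : (fun z => F z ξ) = (Set.Iic (ξ 1)).indicator fun _ => ‖ξ‖ ^ 2 := rfl
  simp only [hF]
  rw [setIntegral_indicator measurableSet_Iic, Set.Ioc_inter_Iic, min_eq_right hle,
    setIntegral_const, smul_eq_mul, Real.volume_real_Ioc, sub_zero, mul_comm]

/-- In the plane-strain ordinary state-based peridynamic model with horizon
radius `δ > 0` and influence function `w = 1`, with weighted volume
`m(δ) = ∫_{‖ξ‖ ≤ δ} ‖ξ‖² dξ`, segment second moment
`m_l(z) = ∫_{‖ξ‖ ≤ δ, ξ₂ ≥ z} ‖ξ‖² dξ` and volume-weight ratio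
`ϖ_l(z) = m_l(z)/m(δ)`, the parameter `β′(δ) = ∫₀^δ ϖ_l(z) dz` admits the
closed form `β′(δ) = (∫₀^δ m_l(z) dz)/m(δ) = (2δ⁵/5)/(πδ⁴/2) = 4δ/(5π)`. -/
theorem betaPrime_closed_form (δ : ℝ) (hδ : 0 < δ)
    (m : ℝ) (hm : m = ∫ ξ in {ξ : EuclideanSpace ℝ (Fin 2) | ‖ξ‖ ≤ δ}, ‖ξ‖ ^ 2)
    (ml : ℝ → ℝ)
    (hml : ∀ z : ℝ, ml z =
      ∫ ξ in {ξ : EuclideanSpace ℝ (Fin 2) | ‖ξ‖ ≤ δ ∧ z ≤ ξ 1}, ‖ξ‖ ^ 2)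
    (ϖ : ℝ → ℝ) (hϖ : ∀ z : ℝ, ϖ z = ml z / m)
    (β' : ℝ) (hβ' : β' = ∫ z in (0 : ℝ)..δ, ϖ z) :
    β' = (∫ z in (0 : ℝ)..δ, ml z) / m ∧
    (∫ z in (0 : ℝ)..δ, ml z) = 2 * δ ^ 5 / 5 ∧
    m = π * δ ^ 4 / 2 ∧
    β' = (2 * δ ^ 5 / 5) / (π * δ ^ 4 / 2) ∧
    β' = 4 * δ / (5 * π) := by
  have hm' : m = π * δ ^ 4 / 2 := by
    rw [hm, EuclideanSpace.setIntegral_disk_of_polar hδ.le 2 _ (fun _ => 1)]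
    · rw [setIntegral_const, Real.volume_real_Ioo_of_le (by linarith [pi_pos])]
      norm_num
      ring
    · intro r θ _
      rw [EuclideanSpace.real_norm_sq_eq, Fin.sum_univ_two]
      simp only [Matrix.cons_val_zero, Matrix.cons_val_one]
      linear_combination r ^ 2 * sin_sq_add_cos_sq θ
  have hI : ∫ z in (0 : ℝ)..δ, ml z = 2 * δ ^ 5 / 5 := by
    simp_rw [hml]
    rw [integral_segmentMoment hδ.le,
      EuclideanSpace.setIntegral_disk_of_polar hδ.le 3 _ (fun θ => max (sin θ) 0),
      integral_max_sin_zero]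
    · norm_num
      ring
    · intro r θ hr
      have hmax : max (r * sin θ) 0 = r * max (sin θ) 0 := by
        rw [mul_max_of_nonneg _ _ hr.le, mul_zero]
      rw [EuclideanSpace.real_norm_sq_eq, Fin.sum_univ_two]
      simp only [Matrix.cons_val_zero, Matrix.cons_val_one, hmax]
      linear_combination r ^ 3 * max (sin θ) 0 * sin_sq_add_cos_sq θ
  have hβ : β' = (∫ z in (0 : ℝ)..δ, ml z) / m := by
    simp_rw [hβ', hϖ, intervalIntegral.integral_div]
  have hβ₂ : β' = (2 * δ ^ 5 / 5) / (π * δ ^ 4 / 2) := by rw [hβ, hI, hm']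
  refine ⟨hβ, hI, hm', hβ₂, ?_⟩
  rw [hβ₂]
  field_simp
  norm_num
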